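/- Any two decompositions of a polynomial f ∈ ℂ[x] of degree at least 2 into compositions of indecomposable polynomials have the same length: if f = f_k ∘ f_{k-1} ∘ ⋯ ∘ f_1 = g_r ∘ g_{r-1} ∘ ⋯ ∘ g_1 with every f_i and every g_j indecomposable, then k = r. -/

import Mathlib

open Polynomial

noncomputable section

/-- A polynomial over ℂ is indecomposable if it has degree at least 2 and cannot be
written as the composition of two polynomials each of degree at least 2. -/
def Indecomposable (f : ℂ[X]) : Prop :=
  2 ≤ f.natDegree ∧ ¬ ∃ g h : ℂ[X], 2 ≤ g.natDegree ∧ 2 ≤ h.natDegree ∧ f = g.comp h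

/-- A decomposition of `f` is a nonempty list `[f₁, …, f_k]` (innermost factor first) of
indecomposable polynomials with `f = f_k ∘ ⋯ ∘ f₁`. -/
def IsDecomposition (l : List ℂ[X]) (f : ℂ[X]) : Prop :=
  l ≠ [] ∧ (∀ p ∈ l, Indecomposable p) ∧ l.foldl (fun q p => p.comp q) X = f

open Function

/-- `σ` behaves on `ℂ[x]` like a generator of the inertia group at infinity of a polynomial of
degree `N`: a polynomial in `x` can only be fixed by `σ ^ i` if `N` divides `i` times its
degree. -/
structure IsInertia {L : Type} [Field L] [Algebra ℂ L] (N : ℕ) (σ : L →ₐ[ℂ] L) (x : L) :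
    Prop where
  transcendental : Transcendental ℂ x
  dvd_of_periodic : ∀ (p : ℂ[X]) (i : ℕ), IsPeriodicPt σ i (aeval x p) → N ∣ i * p.natDegree

/-- The power series `X ^ deg p * p (u / X)`. -/
def homogEval (u : PowerSeries ℂ) (p : ℂ[X]) : PowerSeries ℂ :=
  ((p.map (algebraMap ℂ (PowerSeries ℂ))).scaleRoots PowerSeries.X).eval u

theorem map_constantCoeff_scaleRoots (p : ℂ[X]) :
    ((p.map (algebraMap ℂ (PowerSeries ℂ))).scaleRoots PowerSeries.X).map
      PowerSeries.constantCoeff = C p.leadingCoeff * X ^ p.natDegree := by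
  have hinj : Injective (algebraMap ℂ (PowerSeries ℂ)) := (algebraMap ℂ (PowerSeries ℂ)).injective
  have hid : (PowerSeries.constantCoeff (R := ℂ)).comp (algebraMap ℂ (PowerSeries ℂ))
      = RingHom.id ℂ := by
    ext; simp
  by_cases hp : p = 0
  · simp [hp]
  rw [map_scaleRoots, Polynomial.map_map, hid, Polynomial.map_id, PowerSeries.constantCoeff_X,
    scaleRoots_zero, smul_eq_C_mul]
  rw [leadingCoeff_map, ← RingHom.comp_apply, hid]
  simpa using hp

theorem constantCoeff_homogEval {u : PowerSeries ℂ} (hu : PowerSeries.constantCoeff u = 1)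
    (p : ℂ[X]) : PowerSeries.constantCoeff (homogEval u p) = p.leadingCoeff := by
  rw [homogEval, ← eval_map_apply, map_constantCoeff_scaleRoots, hu]
  simp

theorem exists_homogEval_eq_one {f : ℂ[X]} (hf : f.Monic) (hN : 1 ≤ f.natDegree) :
    ∃ u, homogEval u f = 1 ∧ PowerSeries.constantCoeff u = 1 := by
  set F := (f.map (algebraMap ℂ (PowerSeries ℂ))).scaleRoots PowerSeries.X - 1 with hF
  have hmap : F.map PowerSeries.constantCoeff = X ^ f.natDegree - 1 := by
    rw [hF, Polynomial.map_sub, map_constantCoeff_scaleRoots, hf.leadingCoeff]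
    simp
  have hmonic : F.Monic := by
    have h1 : ((f.map (algebraMap ℂ (PowerSeries ℂ))).scaleRoots PowerSeries.X).Monic :=
      (monic_scaleRoots_iff _).2 (hf.map _)
    refine h1.sub_of_left ?_
    rw [degree_scaleRoots, degree_one, degree_eq_natDegree (hf.map _).ne_zero, hf.natDegree_map]
    exact_mod_cast hN
  obtain ⟨u, hu, hu1⟩ := HenselianRing.is_henselian (I := Ideal.span {PowerSeries.X}) F hmonic 1
    (by
      rw [Ideal.mem_span_singleton, PowerSeries.X_dvd_iff, ← eval_map_apply, hmap]
      simp)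
    (by
      refine IsUnit.map _ ?_
      rw [PowerSeries.isUnit_iff_constantCoeff, ← eval_map_apply, ← derivative_map, hmap]
      simpa [derivative_X_pow] using Nat.one_le_iff_ne_zero.1 hN)
  refine ⟨u, ?_, ?_⟩
  · simpa [hF, IsRoot, sub_eq_zero, homogEval] using hu
  · rw [Ideal.mem_span_singleton, PowerSeries.X_dvd_iff] at hu1
    simpa [sub_eq_zero] using hu1

theorem exists_inertia_of_monic {f : ℂ[X]} (hf : f.Monic) (hN : 1 ≤ f.natDegree) :
    ∃ (L : Type) (_ : Field L) (_ : Algebra ℂ L) (σ : L →ₐ[ℂ] L) (x : L),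
      IsInertia f.natDegree σ x ∧ σ (aeval x f) = aeval x f := by
  obtain ⟨u, huf, hu⟩ := exists_homogEval_eq_one hf hN
  obtain ⟨ζ, hζ⟩ : ∃ ζ : ℂ, IsPrimitiveRoot ζ f.natDegree :=
    ⟨_, Complex.isPrimitiveRoot_exp _ (by omega)⟩
  have hζ0 : ζ ≠ 0 := hζ.ne_zero (by omega)
  let R := PowerSeries ℂ
  let L := FractionRing R
  let g : R →ₐ[ℂ] L := (IsScalarTower.toAlgHom ℂ R L).comp (PowerSeries.rescaleAlgHom ζ)
  have hresc : ∀ r, PowerSeries.rescaleAlgHom ζ r = PowerSeries.rescale ζ r := fun r =>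
    congrArg (fun φ : R →+* R => φ r) (PowerSeries.coe_rescaleAlgHom ζ)
  have hg : Injective g := by
    refine (IsFractionRing.injective R L).comp ?_
    intro a b hab
    ext n
    have := congrArg (PowerSeries.coeff n) hab
    simpa [hresc, hζ0] using this
  let σ : L →ₐ[ℂ] L := IsFractionRing.liftAlgHom hg
  let s : L := algebraMap R L PowerSeries.X
  have hs0 : s ≠ 0 := by
    simp only [s, ne_eq, FaithfulSMul.algebraMap_eq_zero_iff]
    exact PowerSeries.X_ne_zero
  have hσ : ∀ r : R, σ (algebraMap R L r) = algebraMap R L (PowerSeries.rescale ζ r) := by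
    intro r
    rw [← hresc]
    exact IsFractionRing.lift_algebraMap (K := L) (g := g.toRingHom) hg r
  have hσi : ∀ (i : ℕ) (r : R),
      σ^[i] (algebraMap R L r) = algebraMap R L (PowerSeries.rescale (ζ ^ i) r) := by
    intro i r
    induction i with
    | zero => simp
    | succ i ih =>
      rw [iterate_succ_apply', ih, hσ, PowerSeries.rescale_rescale, pow_succ]
  let x : L := algebraMap R L u / s
  have key : ∀ p : ℂ[X], algebraMap R L (homogEval u p) = s ^ p.natDegree * aeval x p := by
    intro p
    have h := scaleRoots_eval₂_mul (p := p.map (algebraMap ℂ R)) (algebraMap R L) x PowerSeries.X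
    have hsx : s * x = algebraMap R L u := mul_div_cancel₀ _ hs0
    rw [hsx, eval₂_hom, natDegree_map, eval₂_map, ← IsScalarTower.algebraMap_eq] at h
    exact h
  refine ⟨L, inferInstance, inferInstance, σ, x, ⟨?_, ?_⟩, ?_⟩
  · rw [transcendental_iff]
    intro p hp
    have h := key p
    rw [hp, mul_zero, map_eq_zero_iff _ (IsFractionRing.injective R L)] at h
    rw [← leadingCoeff_eq_zero, ← constantCoeff_homogEval hu, h, map_zero]
  · intro p i hi
    by_cases hp : p = 0
    · simp [hp]
    have h := congrArg (σ^[i]) (key p)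
    rw [iterate_map_mul, iterate_map_pow, hi, hσi, hσi, PowerSeries.rescale_X, map_mul, mul_pow,
      mul_assoc, ← key, ← map_pow, ← map_mul] at h
    have h := congrArg PowerSeries.constantCoeff (IsFractionRing.injective R L h)
    rw [map_mul, ← map_pow, PowerSeries.constantCoeff_C, constantCoeff_homogEval hu,
      ← PowerSeries.coeff_zero_eq_constantCoeff_apply, PowerSeries.coeff_rescale,
      PowerSeries.coeff_zero_eq_constantCoeff_apply, constantCoeff_homogEval hu, pow_zero,
      one_mul, ← pow_mul] at h
    exact hζ.dvd_of_pow_eq_one _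
      (mul_right_cancel₀ (leadingCoeff_ne_zero.2 hp) (h.symm.trans (one_mul _).symm))
  · have h := key f
    rw [huf, map_one] at h
    have h2 := congrArg σ h
    rw [map_one, map_mul, map_pow, hσ, PowerSeries.rescale_X, map_mul, mul_pow, ← map_pow,
      ← map_pow, hζ.pow_eq_one, map_one, map_one, one_mul, h] at h2
    exact (mul_left_cancel₀ (pow_ne_zero _ hs0) h2).symm

section Inertia

variable {L : Type} [Field L] [Algebra ℂ L] {N : ℕ} {σ : L →ₐ[ℂ] L} {x : L}

theorem iterate_aeval (σ : L →ₐ[ℂ] L) (i : ℕ) (y : L) (p : ℂ[X]) :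
    σ^[i] (aeval y p) = aeval (σ^[i] y) p := by
  induction i with
  | zero => rfl
  | succ i ih => rw [iterate_succ_apply', iterate_succ_apply', ih, ← aeval_algHom_apply]

theorem isPeriodicPt_aeval {i : ℕ} {y : L} (h : IsPeriodicPt σ i y) (p : ℂ[X]) :
    IsPeriodicPt σ i (aeval y p) := by
  rw [IsPeriodicPt, IsFixedPt, iterate_aeval, h.eq]

theorem isPeriodicPt_of_iterate_eq {i j : ℕ} {y : L} (hij : i ≤ j)
    (h : σ^[i] y = σ^[j] y) : IsPeriodicPt σ (j - i) y := by
  refine (show Injective σ from σ.injective).iterate i ?_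
  rw [← iterate_add_apply, Nat.add_sub_cancel' hij, h]

namespace IsInertia

theorem isPeriodicPt_of_comp (hI : IsInertia N σ x) {a b : ℂ[X]} (hN : 1 ≤ N)
    (hdeg : a.natDegree * b.natDegree = N)
    (hfix : σ (aeval x (a.comp b)) = aeval x (a.comp b)) :
    IsPeriodicPt σ a.natDegree (aeval x b) := by
  set k := a.natDegree with hk
  set z := aeval x b with hz
  have hk1 : 1 ≤ k := Nat.pos_of_mul_pos_right (hdeg ▸ hN)
  have hm1 : 1 ≤ b.natDegree := Nat.pos_of_mul_pos_left (hdeg ▸ hN)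
  have hfix' : ∀ i, aeval (σ^[i] z) a = aeval z a := by
    intro i
    rw [← iterate_aeval]
    have : IsFixedPt σ (aeval z a) := by rwa [aeval_comp] at hfix
    exact this.iterate i
  set W : L[X] := a.map (algebraMap ℂ L) - C (aeval z a) with hW
  have hWdeg : W.natDegree = k := by rw [hW, natDegree_sub_C, natDegree_map]
  have hW0 : W ≠ 0 := by rintro h; rw [h, natDegree_zero] at hWdeg; omega
  have hroot : ∀ i, W.IsRoot (σ^[i] z) := by
    intro i
    rw [IsRoot, hW, eval_sub, eval_map_algebraMap, hfix', eval_C, sub_self]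
  obtain ⟨i, hi, j, hj, hij, heq⟩ : ∃ i ∈ Finset.range (k + 1), ∃ j ∈ Finset.range (k + 1),
      i ≠ j ∧ σ^[i] z = σ^[j] z := by
    classical
    refine Finset.exists_ne_map_eq_of_card_lt_of_maps_to (t := W.roots.toFinset) ?_ ?_
    · calc _ ≤ W.roots.card := Multiset.toFinset_card_le _
        _ ≤ k := hWdeg ▸ card_roots' W
        _ < _ := by simp
    · intro i _
      simpa [hW0] using hroot i
  rw [Finset.mem_range] at hi hj
  wlog hlt : i < j generalizing i j
  · exact this j hj i hi hij.symm heq.symm (by omega)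
  have hper := isPeriodicPt_of_iterate_eq hlt.le heq
  have hdvd := hI.dvd_of_periodic b _ hper
  rw [← hdeg] at hdvd
  have := Nat.le_of_dvd (by omega) (Nat.dvd_of_mul_dvd_mul_right hm1 hdvd)
  rwa [show j - i = k by omega] at hper

theorem exists_eq_comp (hI : IsInertia N σ x) {q : ℕ} {g : ℂ[X]} (hN : 1 ≤ N)
    (hqg : q * g.natDegree = N) (hg : IsPeriodicPt σ q (aeval x g)) (b : ℂ[X])
    (hb : IsPeriodicPt σ q (aeval x b)) : ∃ p : ℂ[X], b = p.comp g := by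
  have hq1 : 1 ≤ q := Nat.pos_of_mul_pos_right (hqg ▸ hN)
  have he1 : 1 ≤ g.natDegree := Nat.pos_of_mul_pos_left (hqg ▸ hN)
  induction hn : b.natDegree using Nat.strong_induction_on generalizing b with
  | _ n ih =>
    by_cases hn0 : n = 0
    · rw [hn0] at hn
      exact ⟨C (b.coeff 0), by rw [C_comp]; exact eq_C_of_natDegree_eq_zero hn⟩
    have hdvd := hI.dvd_of_periodic b q hb
    rw [← hqg] at hdvd
    obtain ⟨t, ht⟩ := Nat.dvd_of_mul_dvd_mul_left hq1 hdvd
    have hg0 : g ≠ 0 := by rintro rfl; simp at he1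
    have hb0 : b ≠ 0 := by rintro rfl; simp at hn; omega
    set r : ℂ[X] := C (b.leadingCoeff / g.leadingCoeff ^ t) * X ^ t with hr
    have hlc : g.leadingCoeff ^ t ≠ 0 := pow_ne_zero _ (leadingCoeff_ne_zero.2 hg0)
    have hrg : r.comp g = C (b.leadingCoeff / g.leadingCoeff ^ t) * g ^ t := by simp [hr]
    have hc0 : b.leadingCoeff / g.leadingCoeff ^ t ≠ 0 :=
      div_ne_zero (leadingCoeff_ne_zero.2 hb0) hlc
    have hdeg : (r.comp g).natDegree = b.natDegree := by
      rw [hrg, natDegree_C_mul hc0, natDegree_pow, ht, mul_comm]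
    have hlead : (r.comp g).leadingCoeff = b.leadingCoeff := by
      rw [hrg, leadingCoeff_mul, leadingCoeff_C, leadingCoeff_pow, div_mul_cancel₀ _ hlc]
    have hr0 : r.comp g ≠ 0 := by rw [← leadingCoeff_ne_zero, hlead]; simpa using hb0
    have hlt : (b - r.comp g).natDegree < n := by
      rw [← hn]
      have hlt := degree_sub_lt_left (by
        rw [degree_eq_natDegree hb0, degree_eq_natDegree hr0, hdeg]) hb0
        hlead.symm
      by_cases h0 : b - r.comp g = 0
      · rw [h0, natDegree_zero]
        omega
      · exact natDegree_lt_natDegree h0 hlt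
    have hper : IsPeriodicPt σ q (aeval x (b - r.comp g)) := by
      rw [map_sub, aeval_comp, IsPeriodicPt, IsFixedPt, iterate_map_sub, hb.eq,
        (isPeriodicPt_aeval hg r).eq]
    obtain ⟨p, hp⟩ := ih _ hlt _ hper rfl
    exact ⟨p + r, by rw [add_comp, ← hp, sub_add_cancel]⟩

end IsInertia

open Classical in
/-- The block `{x, σ^q x, …, σ^(q (e - 1)) x}`. -/
def orbitBlock (σ : L →ₐ[ℂ] L) (x : L) (q e : ℕ) : Finset L :=
  (Finset.range e).image fun j => σ^[q * j] x

/-- The monic polynomial whose roots form the block `{x, σ^q x, …, σ^(q (e - 1)) x}`. -/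
def blockPoly (σ : L →ₐ[ℂ] L) (x : L) (q e : ℕ) : L[X] :=
  ∏ y ∈ orbitBlock σ x q e, (X - C y)

theorem blockPoly_monic (q e : ℕ) : (blockPoly σ x q e).Monic :=
  monic_prod_of_monic _ _ fun y _ => monic_X_sub_C y

theorem blockPoly_roots (q e : ℕ) : (blockPoly σ x q e).roots = (orbitBlock σ x q e).val :=
  roots_prod_X_sub_C _

theorem blockPoly_splits (q e : ℕ) : (blockPoly σ x q e).Splits :=
  Splits.prod fun y _ => Splits.X_sub_C y

theorem mem_orbitBlock {q e : ℕ} {y : L} :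
    y ∈ orbitBlock σ x q e ↔ ∃ j < e, σ^[q * j] x = y := by
  simp [orbitBlock]

theorem blockPoly_dvd {q e : ℕ} {W : L[X]} (h : ∀ j < e, W.IsRoot (σ^[q * j] x)) :
    blockPoly σ x q e ∣ W := by
  refine Finset.prod_dvd_of_coprime
    (fun a _ b _ hab => pairwise_coprime_X_sub_C injective_id hab) fun y hy => ?_
  obtain ⟨j, hj, rfl⟩ := mem_orbitBlock.1 hy
  exact dvd_iff_isRoot.2 (h j hj)

theorem iterate_mem_orbitBlock {q e : ℕ} (hx : IsPeriodicPt σ (q * e) x) (he : 0 < e) {i : ℕ}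
    (hi : q ∣ i) : σ^[i] x ∈ orbitBlock σ x q e := by
  obtain ⟨t, rfl⟩ := hi
  refine mem_orbitBlock.2 ⟨t % e, Nat.mod_lt _ he, ?_⟩
  rw [← Nat.mul_mod_mul_left, hx.iterate_mod_apply]

namespace IsInertia

theorem card_orbitBlock (hI : IsInertia N σ x) {q e : ℕ} (hN : 1 ≤ N) (hqe : q * e = N) :
    (orbitBlock σ x q e).card = e := by
  classical
  have hq : 0 < q := Nat.pos_of_mul_pos_right (hqe ▸ hN)
  rw [orbitBlock, Finset.card_image_of_injOn, Finset.card_range]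
  intro i hi j hj hij
  rw [Finset.mem_coe, Finset.mem_range] at hi hj
  wlog hlt : i < j generalizing i j
  · rcases (not_lt.1 hlt).eq_or_lt with h | h
    · exact h.symm
    · exact (this hj hi hij.symm h).symm
  have hper := isPeriodicPt_of_iterate_eq (Nat.mul_le_mul_left q hlt.le) hij
  rw [← aeval_X (R := ℂ) x] at hper
  have hdvd := hI.dvd_of_periodic X _ hper
  rw [natDegree_X, mul_one, ← Nat.mul_sub, ← hqe] at hdvd
  have := Nat.le_of_dvd (by omega) (Nat.dvd_of_mul_dvd_mul_left hq hdvd)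
  omega

theorem natDegree_blockPoly (hI : IsInertia N σ x) {q e : ℕ} (hN : 1 ≤ N) (hqe : q * e = N) :
    (blockPoly σ x q e).natDegree = e := by
  rw [blockPoly, natDegree_prod_of_monic _ _ fun y _ => monic_X_sub_C y]
  simp [hI.card_orbitBlock hN hqe]

theorem eq_blockPoly (hI : IsInertia N σ x) {q e : ℕ} (hN : 1 ≤ N) (hqe : q * e = N) {W : L[X]}
    (hW : W.Monic) (hdeg : W.natDegree = e) (h : ∀ j < e, W.IsRoot (σ^[q * j] x)) :
    W = blockPoly σ x q e :=
  eq_of_monic_of_dvd_of_natDegree_le (blockPoly_monic q e) hW (blockPoly_dvd h)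
    (by rw [hdeg, hI.natDegree_blockPoly hN hqe])

/-- A block polynomial for a block that is a union of blocks of `b` is a polynomial in `b`. -/
theorem exists_comp_eq_blockPoly (hI : IsInertia N σ x) {k q l : ℕ} {b : ℂ[X]} (hN : 1 ≤ N)
    (hkb : k * b.natDegree = N) (hb : IsPeriodicPt σ k (aeval x b)) (hqk : q ∣ k)
    (hql : q * l = N) :
    ∃ A : L[X], A.comp (b.map (algebraMap ℂ L)) = blockPoly σ x q l := by
  obtain ⟨t, rfl⟩ := hqk
  have hk : 0 < q * t := Nat.pos_of_mul_pos_right (hkb ▸ hN)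
  have hm : 0 < b.natDegree := Nat.pos_of_mul_pos_left (hkb ▸ hN)
  have hq : 0 < q := Nat.pos_of_mul_pos_right hk
  have ht : 0 < t := Nat.pos_of_mul_pos_left hk
  have hl : l = t * b.natDegree := Nat.eq_of_mul_eq_mul_left hq (by rw [hql, ← hkb, mul_assoc])
  set z := aeval x b with hz
  set c : L := algebraMap ℂ L b.leadingCoeff with hc
  have hb0 : b ≠ 0 := by rintro rfl; simp at hm
  have hc0 : c ≠ 0 := by simpa [hc] using hb0
  set F : ℕ → L[X] := fun r => C c⁻¹ * (b.map (algebraMap ℂ L) - C (σ^[q * r] z)) with hF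
  have hFdeg : ∀ r, (F r).natDegree = b.natDegree := by
    intro r
    rw [hF, natDegree_C_mul (inv_ne_zero hc0), natDegree_sub_C, natDegree_map]
  have hFmonic : ∀ r, (F r).Monic := by
    intro r
    rw [Monic, hF, leadingCoeff_mul, leadingCoeff_C, leadingCoeff_sub_of_degree_lt,
      leadingCoeff_map, ← hc, inv_mul_cancel₀ hc0]
    rw [degree_map]
    exact degree_C_le.trans_lt (natDegree_pos_iff_degree_pos.1 hm)
  refine ⟨∏ r ∈ Finset.range t, C c⁻¹ * (X - C (σ^[q * r] z)), ?_⟩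
  rw [Polynomial.prod_comp]
  simp only [mul_comp, C_comp, sub_comp, X_comp]
  refine hI.eq_blockPoly (W := ∏ r ∈ Finset.range t, F r) hN hql
    (monic_prod_of_monic _ _ fun r _ => hFmonic r) ?_ ?_
  · rw [natDegree_prod_of_monic _ _ fun r _ => hFmonic r]
    simp [hFdeg, hl]
  · intro j _
    rw [IsRoot, eval_prod]
    refine Finset.prod_eq_zero (i := j % t) (by simpa using Nat.mod_lt _ ht) ?_
    rw [hF, eval_mul, eval_sub, eval_C, eval_C, eval_map_algebraMap, ← iterate_aeval,
      ← Nat.mul_mod_mul_left, hb.iterate_mod_apply, sub_self, mul_zero]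

end IsInertia

/-- Applying a linear functional coefficientwise to a polynomial in `b` gives a polynomial
in `b`. -/
theorem coeff_sum_linear (φ : L →ₗ[ℂ] ℂ) (A : L[X]) (b : ℂ[X]) (n : ℕ) :
    ((∑ i ∈ A.support, C (φ (A.coeff i)) * X ^ i : ℂ[X]).comp b).coeff n =
      φ ((A.comp (b.map (algebraMap ℂ L))).coeff n) := by
  rw [comp_eq_sum_left (p := A), Polynomial.sum, Polynomial.sum_comp, finsetSum_coeff,
    finsetSum_coeff, map_sum]
  refine Finset.sum_congr rfl fun i _ => ?_
  rw [mul_comp, C_comp, X_pow_comp, coeff_C_mul, coeff_C_mul, ← Polynomial.map_pow, coeff_map,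
    mul_comm (A.coeff i), ← Algebra.smul_def, map_smul, smul_eq_mul, mul_comm]

theorem exists_comp_eq_comp_of_map {A D P : L[X]} {b d : ℂ[X]} (hP : P.Monic)
    (hA : A.comp (b.map (algebraMap ℂ L)) = P) (hD : D.comp (d.map (algebraMap ℂ L)) = P) :
    ∃ p q : ℂ[X], p.comp b = q.comp d ∧ (p.comp b).natDegree = P.natDegree := by
  obtain ⟨φ, hφ⟩ := LinearMap.exists_leftInverse_of_injective (Algebra.linearMap ℂ L)
    (LinearMap.ker_eq_bot.2 (algebraMap ℂ L).injective)
  have hφ1 : φ 1 = 1 := by simpa using LinearMap.congr_fun hφ 1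
  refine ⟨∑ i ∈ A.support, C (φ (A.coeff i)) * X ^ i,
    ∑ i ∈ D.support, C (φ (D.coeff i)) * X ^ i, ?_, ?_⟩
  · ext n
    rw [coeff_sum_linear, coeff_sum_linear, hA, hD]
  · refine natDegree_eq_of_le_of_coeff_ne_zero ?_ ?_
    · rw [natDegree_le_iff_coeff_eq_zero]
      intro n hn
      rw [coeff_sum_linear, hA, coeff_eq_zero_of_natDegree_lt hn, map_zero]
    · rw [coeff_sum_linear, hA, hP.coeff_natDegree, hφ1]
      exact one_ne_zero

namespace IsInertia

/-- Two right factors of `f` have a common left multiple of small degree. -/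
theorem exists_join (hI : IsInertia N σ x) {k k' : ℕ} {b d : ℂ[X]} (hN : 1 ≤ N)
    (hkb : k * b.natDegree = N) (hkd : k' * d.natDegree = N)
    (hb : IsPeriodicPt σ k (aeval x b)) (hd : IsPeriodicPt σ k' (aeval x d)) :
    ∃ p q : ℂ[X], p.comp b = q.comp d ∧ k.gcd k' * (p.comp b).natDegree = N ∧
      IsPeriodicPt σ (k.gcd k') (aeval x (p.comp b)) := by
  obtain ⟨l, hl⟩ : k.gcd k' ∣ N := (Nat.gcd_dvd_left _ _).trans ⟨_, hkb.symm⟩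
  obtain ⟨A, hA⟩ := hI.exists_comp_eq_blockPoly hN hkb hb (Nat.gcd_dvd_left k k') hl.symm
  obtain ⟨D, hD⟩ := hI.exists_comp_eq_blockPoly hN hkd hd (Nat.gcd_dvd_right k k') hl.symm
  obtain ⟨p, q, hpq, hdeg⟩ := exists_comp_eq_comp_of_map (blockPoly_monic _ _) hA hD
  refine ⟨p, q, hpq, by rw [hdeg, hI.natDegree_blockPoly hN hl.symm, hl], ?_⟩
  refine IsPeriodicPt.gcd ?_ ?_
  · rw [aeval_comp]
    exact isPeriodicPt_aeval hb p
  · rw [hpq, aeval_comp]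
    exact isPeriodicPt_aeval hd q

end IsInertia

/-- The bivariate polynomial `p(X) - p(Y)`. -/
def diffPoly (p : ℂ[X]) : ℂ[X][X] := p.map C - C p

theorem swap_diffPoly (p : ℂ[X]) : Bivariate.swap (diffPoly p) = -diffPoly p := by
  rw [diffPoly, map_sub, Bivariate.swap_map_C, Bivariate.swap_C, neg_sub]

theorem swap_dvd_diffPoly {P : ℂ[X][X]} {p : ℂ[X]} (h : P ∣ diffPoly p) :
    Bivariate.swap P ∣ diffPoly p := by
  obtain ⟨Q, hQ⟩ := h
  have h : Bivariate.swap P ∣ Bivariate.swap (diffPoly p) :=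
    ⟨Bivariate.swap Q, by rw [hQ, map_mul]⟩
  rw [swap_diffPoly] at h
  exact (dvd_neg (α := ℂ[X][X])).1 h

theorem monic_C_mul_diffPoly {b : ℂ[X]} (hb : 0 < b.natDegree) :
    (C (C b.leadingCoeff⁻¹) * diffPoly b).Monic := by
  have hb0 : b.leadingCoeff ≠ 0 := by
    rw [Ne, leadingCoeff_eq_zero]
    rintro rfl
    simp at hb
  rw [Monic, leadingCoeff_mul, leadingCoeff_C, diffPoly, leadingCoeff_sub_of_degree_lt,
    leadingCoeff_map_of_injective C_injective, ← C_mul, inv_mul_cancel₀ hb0, C_1]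
  rw [degree_map_eq_of_injective C_injective]
  exact degree_C_le.trans_lt (natDegree_pos_iff_degree_pos.1 hb)

theorem toRingHom_aeval_comp_C (x : L) :
    (aeval x : ℂ[X] →ₐ[ℂ] L).toRingHom.comp C = algebraMap ℂ L := by
  ext r
  simp

theorem map_diffPoly (x : L) (p : ℂ[X]) :
    (diffPoly p).map (aeval x : ℂ[X] →ₐ[ℂ] L).toRingHom =
      p.map (algebraMap ℂ L) - C (aeval x p) := by
  rw [diffPoly, Polynomial.map_sub, Polynomial.map_map, map_C, toRingHom_aeval_comp_C]
  rfl

theorem blockPoly_dvd_sub {q : ℕ} {p : ℂ[X]} (hp : IsPeriodicPt σ q (aeval x p)) (e : ℕ) :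
    blockPoly σ x q e ∣ p.map (algebraMap ℂ L) - C (aeval x p) := by
  refine blockPoly_dvd fun j _ => ?_
  rw [IsRoot, eval_sub, eval_C, eval_map_algebraMap, ← iterate_aeval, (hp.mul_const j).eq,
    sub_self]

namespace IsInertia

theorem dvd_blockPoly (hI : IsInertia N σ x) {k k' e : ℕ} {b d : ℂ[X]} (hN : 1 ≤ N)
    (hx : IsPeriodicPt σ N x) (hkb : k * b.natDegree = N) (hkd : k' * d.natDegree = N)
    (hb : IsPeriodicPt σ k (aeval x b)) (he : k.lcm k' * e = N) {W : L[X]}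
    (hWb : W ∣ b.map (algebraMap ℂ L) - C (aeval x b))
    (hWd : W ∣ d.map (algebraMap ℂ L) - C (aeval x d)) : W ∣ blockPoly σ x (k.lcm k') e := by
  have hd1 : 0 < d.natDegree := Nat.pos_of_mul_pos_left (hkd ▸ hN)
  have hm : 0 < b.natDegree := Nat.pos_of_mul_pos_left (hkb ▸ hN)
  have he1 : 0 < e := Nat.pos_of_mul_pos_left (he ▸ hN)
  have hb0 : b ≠ 0 := by rintro rfl; simp at hm
  have hblock : blockPoly σ x k b.natDegree ∣ b.map (algebraMap ℂ L) - C (aeval x b) :=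
    blockPoly_dvd_sub hb _
  have hdeg : (b.map (algebraMap ℂ L) - C (aeval x b)).natDegree = b.natDegree := by
    rw [natDegree_sub_C, natDegree_map]
  have hB0 : b.map (algebraMap ℂ L) - C (aeval x b) ≠ 0 := by
    intro h
    rw [h, natDegree_zero] at hdeg
    omega
  have hWblock : W ∣ blockPoly σ x k b.natDegree := by
    refine hWb.trans ?_
    refine (associated_of_dvd_of_natDegree_le hblock hB0 ?_).symm.dvd
    rw [hdeg, hI.natDegree_blockPoly hN hkb]
  have hW0 : W ≠ 0 := ne_zero_of_dvd_ne_zero hB0 hWb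
  have hbl0 := (blockPoly_monic (σ := σ) (x := x) k b.natDegree).ne_zero
  have hle := roots.le_of_dvd hbl0 hWblock
  rw [blockPoly_roots] at hle
  refine ((blockPoly_splits k b.natDegree).of_dvd hbl0 hWblock).dvd_of_roots_le_roots hW0 ?_
  rw [blockPoly_roots, Multiset.le_iff_subset (Multiset.nodup_of_le hle (Finset.nodup _))]
  intro y hy
  obtain ⟨j, hj, rfl⟩ := mem_orbitBlock.1 (Finset.mem_def.2 (Multiset.mem_of_le hle hy))
  have hroot : (d.map (algebraMap ℂ L) - C (aeval x d)).IsRoot (σ^[k * j] x) :=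
    (isRoot_of_mem_roots hy).dvd hWd
  rw [IsRoot, eval_sub, eval_C, eval_map_algebraMap, ← iterate_aeval, sub_eq_zero] at hroot
  have hdvd := hI.dvd_of_periodic d _ hroot
  rw [← hkd] at hdvd
  exact Finset.mem_def.1 (iterate_mem_orbitBlock (he.symm ▸ hx) he1
    (Nat.lcm_dvd (dvd_mul_right k j) (Nat.dvd_of_mul_dvd_mul_right hd1 hdvd)))

theorem isPeriodicPt_coeff_blockPoly (hI : IsInertia N σ x) {q e : ℕ} (hN : 1 ≤ N)
    (hx : IsPeriodicPt σ N x) (hqe : q * e = N) (i : ℕ) :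
    IsPeriodicPt σ q ((blockPoly σ x q e).coeff i) := by
  have he : 0 < e := Nat.pos_of_mul_pos_left (hqe ▸ hN)
  have hmap : (blockPoly σ x q e).map (σ ^ q : L →ₐ[ℂ] L).toRingHom = blockPoly σ x q e := by
    refine hI.eq_blockPoly hN hqe ((blockPoly_monic q e).map _) ?_ ?_
    · rw [natDegree_map, hI.natDegree_blockPoly hN hqe]
    · intro j _
      have hmem : σ^[q * j + N - q] x ∈ orbitBlock σ x q e := by
        refine iterate_mem_orbitBlock (hqe.symm ▸ hx) he ?_
        exact Nat.dvd_sub (dvd_add (dvd_mul_right _ _) ⟨_, hqe.symm⟩) dvd_rfl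
      have hqN : q ≤ N := hqe ▸ Nat.le_mul_of_pos_right q he
      have heq : σ^[q * j] x = (σ ^ q : L →ₐ[ℂ] L).toRingHom (σ^[q * j + N - q] x) := by
        change _ = (σ ^ q : L →ₐ[ℂ] L) _
        rw [AlgHom.coe_pow, ← iterate_add_apply, show q + (q * j + N - q) = q * j + N by omega,
          iterate_add_apply, hx.eq]
      rw [← Finset.mem_val, ← blockPoly_roots] at hmem
      rw [heq, IsRoot, eval_map_apply, (isRoot_of_mem_roots hmem).eq_zero, map_zero]
  have h := congrArg (fun p => coeff p i) hmap
  rw [coeff_map] at h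
  change (σ ^ q : L →ₐ[ℂ] L) _ = _ at h
  rwa [AlgHom.coe_pow] at h

end IsInertia

theorem coeff_coeff_swap (p : ℂ[X][X]) (i j : ℕ) :
    ((Bivariate.swap p).coeff i).coeff j = (p.coeff j).coeff i := by
  induction p using Polynomial.induction_on' with
  | add p q hp hq => simp only [map_add, coeff_add, hp, hq]
  | monomial n f =>
    induction f using Polynomial.induction_on' with
    | add f g hf hg => simp only [map_add, coeff_add, hf, hg]
    | monomial m r =>
      rw [Bivariate.swap_monomial_monomial]
      simp only [coeff_monomial]
      split_ifs <;> simp_all [coeff_monomial]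

namespace IsInertia

theorem map_dvd_blockPoly (hI : IsInertia N σ x) {k k' e : ℕ} {b d : ℂ[X]} (hN : 1 ≤ N)
    (hx : IsPeriodicPt σ N x) (hkb : k * b.natDegree = N) (hkd : k' * d.natDegree = N)
    (hb : IsPeriodicPt σ k (aeval x b)) (he : k.lcm k' * e = N) {W : ℂ[X][X]}
    (hWb : W ∣ diffPoly b) (hWd : W ∣ diffPoly d) :
    W.map (aeval x : ℂ[X] →ₐ[ℂ] L).toRingHom ∣ blockPoly σ x (k.lcm k') e := by
  refine hI.dvd_blockPoly hN hx hkb hkd hb he ?_ ?_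
  · rw [← map_diffPoly]
    exact Polynomial.map_dvd _ hWb
  · rw [← map_diffPoly]
    exact Polynomial.map_dvd _ hWd

/-- A block polynomial of a common refinement of two block systems has coefficients in `ℂ[x]`. -/
theorem exists_map_eq_blockPoly (hI : IsInertia N σ x) {k k' e : ℕ} {b d : ℂ[X]} (hN : 1 ≤ N)
    (hx : IsPeriodicPt σ N x) (hkb : k * b.natDegree = N) (hkd : k' * d.natDegree = N)
    (hb : IsPeriodicPt σ k (aeval x b)) (hd : IsPeriodicPt σ k' (aeval x d))
    (he : k.lcm k' * e = N) :
    ∃ P : ℂ[X][X], P.Monic ∧ P ∣ diffPoly b ∧ P ∣ diffPoly d ∧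
      P.map (aeval x : ℂ[X] →ₐ[ℂ] L).toRingHom = blockPoly σ x (k.lcm k') e := by
  classical
  let K := FractionRing ℂ[X]
  let φ : ℂ[X] →+* L := (aeval x : ℂ[X] →ₐ[ℂ] L).toRingHom
  have hφ : Injective φ := transcendental_iff_injective.1 hI.transcendental
  let ι := algebraMap ℂ[X] K
  have hι : Injective ι := IsFractionRing.injective ℂ[X] K
  let ψ : K →+* L := IsFractionRing.lift hφ
  have hψ : ψ.comp ι = φ := RingHom.ext fun r => IsFractionRing.lift_algebraMap hφ r
  have hBψ : ∀ p, ((diffPoly p).map ι).map ψ = p.map (algebraMap ℂ L) - C (aeval x p) := by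
    intro p
    rw [Polynomial.map_map, hψ, map_diffPoly]
  set G : K[X] := EuclideanDomain.gcd ((diffPoly b).map ι) ((diffPoly d).map ι) with hG
  have hGb : G ∣ (diffPoly b).map ι := EuclideanDomain.gcd_dvd_left _ _
  have hGd : G ∣ (diffPoly d).map ι := EuclideanDomain.gcd_dvd_right _ _
  have hBmonic := monic_C_mul_diffPoly (Nat.pos_of_mul_pos_left (hkb ▸ hN) : 0 < b.natDegree)
  obtain ⟨P, hPG⟩ := IsIntegrallyClosed.eq_map_mul_C_of_dvd K hBmonic
    (hGb.trans (by rw [Polynomial.map_mul]; exact dvd_mul_left _ _))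
  have hB0 : (diffPoly b).map ι ≠ 0 :=
    (Polynomial.map_ne_zero_iff hι).2 (right_ne_zero_of_mul hBmonic.ne_zero)
  have hG0 : G.leadingCoeff ≠ 0 := leadingCoeff_ne_zero.2 (ne_zero_of_dvd_ne_zero hB0 hGb)
  have hPmonic : P.Monic := by
    refine monic_of_injective hι ?_
    have := congrArg leadingCoeff hPG
    rw [leadingCoeff_mul, leadingCoeff_C] at this
    exact mul_right_cancel₀ hG0 (this.trans (one_mul _).symm)
  have hPb : P ∣ diffPoly b := (map_dvd_map ι hι hPmonic).1 ((Dvd.intro _ hPG).trans hGb)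
  have hPd : P ∣ diffPoly d := (map_dvd_map ι hι hPmonic).1 ((Dvd.intro _ hPG).trans hGd)
  refine ⟨P, hPmonic, hPb, hPd, eq_of_monic_of_associated (hPmonic.map φ) (blockPoly_monic _ _)
    (associated_of_dvd_dvd (hI.map_dvd_blockPoly hN hx hkb hkd hb he hPb hPd) ?_)⟩
  have hGψ : blockPoly σ x (k.lcm k') e ∣ G.map ψ := by
    rw [hG, EuclideanDomain.gcd_eq_gcd_ab, Polynomial.map_add, Polynomial.map_mul,
      Polynomial.map_mul, hBψ, hBψ]
    refine dvd_add (Dvd.dvd.mul_right ?_ _) (Dvd.dvd.mul_right ?_ _)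
    · exact blockPoly_dvd_sub (hb.trans_dvd (Nat.dvd_lcm_left k k')) e
    · exact blockPoly_dvd_sub (hd.trans_dvd (Nat.dvd_lcm_right k k')) e
  rw [← hPG, Polynomial.map_mul, Polynomial.map_map, hψ, map_C] at hGψ
  exact (IsUnit.dvd_mul_right (isUnit_C.2 (IsUnit.mk0 _ ((map_ne_zero ψ).2 hG0)))).1 hGψ

/-- Two right factors of `f` have a common right factor of large degree. -/
theorem exists_meet (hI : IsInertia N σ x) {k k' e : ℕ} {b d : ℂ[X]} (hN : 1 ≤ N)
    (hx : IsPeriodicPt σ N x) (hkb : k * b.natDegree = N) (hkd : k' * d.natDegree = N)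
    (hb : IsPeriodicPt σ k (aeval x b)) (hd : IsPeriodicPt σ k' (aeval x d))
    (he : k.lcm k' * e = N) :
    ∃ g : ℂ[X], g.natDegree = e ∧ IsPeriodicPt σ (k.lcm k') (aeval x g) := by
  have hq1 : 0 < k.lcm k' := Nat.pos_of_mul_pos_right (he ▸ hN)
  have he1 : 0 < e := Nat.pos_of_mul_pos_left (he ▸ hN)
  obtain ⟨P, hPmonic, hPb, hPd, hPφ⟩ := hI.exists_map_eq_blockPoly hN hx hkb hkd hb hd he
  have hcoeff : ∀ i, IsPeriodicPt σ (k.lcm k') (aeval x (P.coeff i)) := by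
    intro i
    have := hI.isPeriodicPt_coeff_blockPoly hN hx he i
    rwa [← hPφ, coeff_map] at this
  obtain ⟨i, hi⟩ : ∃ i, (P.coeff i).natDegree ≠ 0 := by
    by_contra! hall
    have hP : P = (P.map constantCoeff).map C := by
      ext1 i
      rw [coeff_map, coeff_map, constantCoeff_apply]
      exact eq_C_of_natDegree_eq_zero (hall i)
    have hmem := iterate_mem_orbitBlock (he.symm ▸ hx : IsPeriodicPt σ (k.lcm k' * e) x) he1
      (dvd_zero _)
    rw [← Finset.mem_val, ← blockPoly_roots, ← hPφ, hP, Polynomial.map_map,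
      toRingHom_aeval_comp_C] at hmem
    have hroot := (isRoot_of_mem_roots hmem).eq_zero
    rw [iterate_zero_apply, eval_map_algebraMap] at hroot
    have h0 := transcendental_iff.1 hI.transcendental _ hroot
    rw [h0, Polynomial.map_zero] at hP
    exact hPmonic.ne_zero hP
  refine ⟨P.coeff i, ?_, hcoeff i⟩
  have hswap : (Bivariate.swap P).natDegree ≤ e := by
    have h := hI.map_dvd_blockPoly hN hx hkb hkd hb he (W := Bivariate.swap P)
      (swap_dvd_diffPoly hPb) (swap_dvd_diffPoly hPd)
    have := natDegree_le_of_dvd h (blockPoly_monic _ _).ne_zero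
    rwa [natDegree_map_eq_of_injective (transcendental_iff_injective.1 hI.transcendental),
      hI.natDegree_blockPoly hN he] at this
  have hle : (P.coeff i).natDegree ≤ e := by
    refine le_trans (le_natDegree_of_ne_zero fun h => ?_) hswap
    have := coeff_coeff_swap P (P.coeff i).natDegree i
    rw [h, coeff_zero, coeff_natDegree, eq_comm, leadingCoeff_eq_zero] at this
    simp [this] at hi
  have hdiv := hI.dvd_of_periodic _ _ (hcoeff i)
  rw [← he] at hdiv
  exact le_antisymm hle
    (Nat.le_of_dvd (Nat.pos_of_ne_zero hi) (Nat.dvd_of_mul_dvd_mul_left hq1 hdiv))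

end IsInertia

end Inertia

theorem lcm_mul_gcd_of_mul_eq_mul {k k' m n N : ℕ} (hN : 1 ≤ N) (hkm : k * m = N)
    (hkn : k' * n = N) : k.lcm k' * m.gcd n = N := by
  have hk : 0 < k := Nat.pos_of_mul_pos_right (hkm ▸ hN)
  have hg : 0 < k.gcd k' := Nat.gcd_pos_of_pos_left _ hk
  have hlcm := Nat.gcd_mul_lcm k k'
  refine Nat.eq_of_mul_eq_mul_left hg ?_
  calc k.gcd k' * (k.lcm k' * m.gcd n) = k * k' * m.gcd n := by rw [← mul_assoc, hlcm]
    _ = ((k * k') * m).gcd ((k * k') * n) := (Nat.gcd_mul_left _ _ _).symm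
    _ = (k' * N).gcd (k * N) := by
      congr 1
      · rw [← hkm]; ring
      · rw [← hkn]; ring
    _ = k.gcd k' * N := by rw [Nat.gcd_mul_right, Nat.gcd_comm]

theorem exists_inertia {f : ℂ[X]} (hf : 1 ≤ f.natDegree) :
    ∃ (L : Type) (_ : Field L) (_ : Algebra ℂ L) (σ : L →ₐ[ℂ] L) (x : L),
      IsInertia f.natDegree σ x ∧ σ (aeval x f) = aeval x f := by
  have hc : f.leadingCoeff ≠ 0 := by
    rw [Ne, leadingCoeff_eq_zero]
    rintro rfl
    simp at hf
  have hmonic : (C f.leadingCoeff⁻¹ * f).Monic := by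
    rw [Monic, leadingCoeff_mul, leadingCoeff_C, inv_mul_cancel₀ hc]
  have hdeg : (C f.leadingCoeff⁻¹ * f).natDegree = f.natDegree :=
    natDegree_C_mul (inv_ne_zero hc)
  obtain ⟨L, hL, hA, σ, x, hI, hfix⟩ := exists_inertia_of_monic hmonic (hdeg.symm ▸ hf)
  refine ⟨L, hL, hA, σ, x, hdeg ▸ hI, ?_⟩
  rw [map_mul, map_mul, aeval_C, AlgHom.commutes] at hfix
  exact mul_left_cancel₀ (by simpa using hc) hfix

/-- Two right factors of a polynomial have a common right factor whose degree is the gcd of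
their degrees. -/
theorem exists_common_right_factor {f a b c d : ℂ[X]} (hf : 1 ≤ f.natDegree)
    (hab : f = a.comp b) (hcd : f = c.comp d) :
    ∃ g b' d' : ℂ[X], g.natDegree = b.natDegree.gcd d.natDegree ∧
      b = b'.comp g ∧ d = d'.comp g := by
  obtain ⟨L, _, _, σ, x, hI, hfix⟩ := exists_inertia hf
  have hkm : a.natDegree * b.natDegree = f.natDegree := by rw [hab, natDegree_comp]
  have hkn : c.natDegree * d.natDegree = f.natDegree := by rw [hcd, natDegree_comp]
  have hx : IsPeriodicPt σ f.natDegree x := by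
    simpa using hI.isPeriodicPt_of_comp (a := f) (b := X) hf (by simp) (by simpa using hfix)
  have hb := hI.isPeriodicPt_of_comp hf hkm (hab ▸ hfix)
  have hd := hI.isPeriodicPt_of_comp hf hkn (hcd ▸ hfix)
  have he := lcm_mul_gcd_of_mul_eq_mul hf hkm hkn
  obtain ⟨g, hg, hper⟩ := hI.exists_meet hf hx hkm hkn hb hd he
  rw [← hg] at he
  obtain ⟨b', hb'⟩ := hI.exists_eq_comp hf he hper b (hb.trans_dvd (Nat.dvd_lcm_left _ _))
  obtain ⟨d', hd'⟩ := hI.exists_eq_comp hf he hper d (hd.trans_dvd (Nat.dvd_lcm_right _ _))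
  exact ⟨g, b', d', hg, hb', hd'⟩

/-- Two right factors of a polynomial `f` have a common left multiple that is a right factor of
`f` and whose degree is the lcm of their degrees. -/
theorem exists_common_left_multiple {f a b c d : ℂ[X]} (hf : 1 ≤ f.natDegree)
    (hab : f = a.comp b) (hcd : f = c.comp d) :
    ∃ p q r : ℂ[X], p.comp b = q.comp d ∧
      (p.comp b).natDegree = b.natDegree.lcm d.natDegree ∧ f = r.comp (p.comp b) := by
  obtain ⟨L, _, _, σ, x, hI, hfix⟩ := exists_inertia hf
  have hkm : a.natDegree * b.natDegree = f.natDegree := by rw [hab, natDegree_comp]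
  have hkn : c.natDegree * d.natDegree = f.natDegree := by rw [hcd, natDegree_comp]
  have hb := hI.isPeriodicPt_of_comp hf hkm (hab ▸ hfix)
  have hd := hI.isPeriodicPt_of_comp hf hkn (hcd ▸ hfix)
  obtain ⟨p, q, hpq, hdeg, hper⟩ := hI.exists_join hf hkm hkn hb hd
  obtain ⟨r, hr⟩ := hI.exists_eq_comp hf hdeg hper f
    (by simpa using (show IsPeriodicPt σ 1 (aeval x f) from hfix).const_mul _)
  refine ⟨p, q, r, hpq, ?_, hr⟩
  have he := lcm_mul_gcd_of_mul_eq_mul hf ((mul_comm _ _).trans hkm) ((mul_comm _ _).trans hkn)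
  refine Nat.eq_of_mul_eq_mul_left (Nat.gcd_pos_of_pos_left _ ?_)
    (hdeg.trans (he.symm.trans (mul_comm _ _)))
  exact Nat.pos_of_mul_pos_right (hkm ▸ hf)

theorem comp_right_cancel {p q b : ℂ[X]} (hb : 1 ≤ b.natDegree) (h : p.comp b = q.comp b) :
    p = q := by
  rw [← sub_eq_zero, ← sub_comp, Polynomial.comp_eq_zero_iff] at h
  rcases h with h | ⟨-, h⟩
  · exact sub_eq_zero.1 h
  · rw [h, natDegree_C] at hb
    omega

theorem exists_comp_eq_X {u : ℂ[X]} (hu : u.natDegree = 1) :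
    ∃ v : ℂ[X], v.natDegree = 1 ∧ u.comp v = X ∧ v.comp u = X := by
  obtain ⟨a, ha, b, rfl⟩ := natDegree_eq_one.1 hu
  have hv : (C a⁻¹ * X + C (-(a⁻¹ * b))).natDegree = 1 := natDegree_linear (inv_ne_zero ha)
  refine ⟨C a⁻¹ * X + C (-(a⁻¹ * b)), hv, ?_, ?_⟩
  · simp only [add_comp, mul_comp, C_comp, X_comp, mul_add, ← mul_assoc, ← C_mul, mul_neg, C_neg,
      mul_inv_cancel₀ ha, C_1, one_mul, neg_add_cancel_right]
  · simp only [add_comp, mul_comp, C_comp, X_comp, mul_add, ← mul_assoc, ← C_mul,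
      inv_mul_cancel₀ ha, C_1, one_mul, C_neg, neg_comp, add_neg_cancel_right]

theorem Indecomposable.natDegree_left {f g h : ℂ[X]} (hf : Indecomposable f) (hgh : f = g.comp h)
    (hh : 2 ≤ h.natDegree) : g.natDegree = 1 := by
  have h1 := hf.1
  have h2 : ¬ 2 ≤ g.natDegree := fun hg => hf.2 ⟨g, h, hg, hh, hgh⟩
  have h3 : g.natDegree ≠ 0 := by
    intro h0
    rw [hgh, natDegree_comp, h0, zero_mul] at h1
    omega
  omega

theorem Indecomposable.comp_linear {b u : ℂ[X]} (hb : Indecomposable b) (hu : u.natDegree = 1) :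
    Indecomposable (b.comp u) := by
  obtain ⟨v, hv, huv, -⟩ := exists_comp_eq_X hu
  refine ⟨by rw [natDegree_comp, hu, mul_one]; exact hb.1, ?_⟩
  rintro ⟨g, h, hg, hh, hgh⟩
  refine hb.2 ⟨g, h.comp v, hg, by rwa [natDegree_comp, hv, mul_one], ?_⟩
  rw [← Polynomial.comp_assoc, ← hgh, Polynomial.comp_assoc, huv, comp_X]

/-- `HasLength f k` says that `f` is, up to a linear polynomial on the left, a composition of `k`
indecomposable polynomials. -/
inductive HasLength : ℂ[X] → ℕ → Prop
  | linear {f : ℂ[X]} (hf : f.natDegree = 1) : HasLength f 0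
  | comp {g b : ℂ[X]} {k : ℕ} (hg : HasLength g k) (hb : Indecomposable b) :
    HasLength (g.comp b) (k + 1)

theorem HasLength.one_le_natDegree {f : ℂ[X]} {k : ℕ} (h : HasLength f k) :
    1 ≤ f.natDegree := by
  induction h with
  | linear hf => exact hf.ge
  | comp _ hb ih =>
    rw [natDegree_comp]
    exact Nat.mul_pos ih (by have := hb.1; omega)

theorem HasLength.comp_linear {f u : ℂ[X]} {k : ℕ} (h : HasLength f k) (hu : u.natDegree = 1) :
    HasLength (f.comp u) k := by
  cases h with
  | linear hf => exact .linear (by rw [natDegree_comp, hf, hu])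
  | comp hg hb =>
    rw [Polynomial.comp_assoc]
    exact .comp hg (hb.comp_linear hu)

theorem exists_indecomposable_right_factor {f : ℂ[X]} (hf : 2 ≤ f.natDegree) :
    ∃ g b : ℂ[X], Indecomposable b ∧ f = g.comp b := by
  induction hn : f.natDegree using Nat.strong_induction_on generalizing f with
  | _ n ih =>
    by_cases hi : Indecomposable f
    · exact ⟨X, f, hi, X_comp.symm⟩
    · obtain ⟨g, h, hg, hh, rfl⟩ : ∃ g h : ℂ[X], 2 ≤ g.natDegree ∧ 2 ≤ h.natDegree ∧
          f = g.comp h := by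
        by_contra hcon
        exact hi ⟨hf, hcon⟩
      obtain ⟨g', b, hb, rfl⟩ := ih h.natDegree
        (by rw [← hn, natDegree_comp]; nlinarith) hh rfl
      exact ⟨g.comp g', b, hb, (Polynomial.comp_assoc _ _ _).symm⟩

theorem exists_hasLength {f : ℂ[X]} (hf : 1 ≤ f.natDegree) : ∃ k, HasLength f k := by
  induction hn : f.natDegree using Nat.strong_induction_on generalizing f with
  | _ n ih =>
    rcases hf.eq_or_lt with h1 | h2
    · exact ⟨0, .linear h1.symm⟩
    · obtain ⟨g, b, hb, rfl⟩ := exists_indecomposable_right_factor h2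
      have hb2 := hb.1
      rw [natDegree_comp] at hf hn
      have hg : 1 ≤ g.natDegree := Nat.pos_of_mul_pos_right hf
      obtain ⟨k, hk⟩ := ih g.natDegree (by rw [← hn]; nlinarith) hg rfl
      exact ⟨k + 1, .comp hk hb⟩

theorem Indecomposable.of_comp_eq_comp {p b q d : ℂ[X]} (hd : Indecomposable d)
    (h : p.comp b = q.comp d) (hb : 1 ≤ b.natDegree)
    (hcop : b.natDegree.Coprime d.natDegree) (hp : p.natDegree = d.natDegree) :
    Indecomposable p := by
  refine ⟨hp ▸ hd.1, ?_⟩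
  rintro ⟨p₁, p₂, h₁, h₂, rfl⟩
  have h0 : 1 ≤ ((p₁.comp p₂).comp b).natDegree := by
    rw [natDegree_comp, hp]
    exact Nat.mul_pos (by have := hd.1; omega) hb
  obtain ⟨s, -, d', hs, -, hd'⟩ :=
    exists_common_right_factor h0 (Polynomial.comp_assoc p₁ p₂ b) h
  rw [← hp, natDegree_comp] at hcop
  have hs2 : s.natDegree = p₂.natDegree := by
    rw [hs, ← hp, natDegree_comp, natDegree_comp, mul_comm p₁.natDegree, Nat.gcd_mul_left,
      (hcop.coprime_dvd_right (dvd_mul_right _ _)).gcd_eq_one, mul_one]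
  have hd1 := hd.natDegree_left hd' (hs2 ▸ h₂)
  have hdeg : d.natDegree = d'.natDegree * s.natDegree := by rw [← natDegree_comp, ← hd']
  rw [← hp, natDegree_comp, hd1, hs2, one_mul] at hdeg
  nlinarith

theorem HasLength.unique {f : ℂ[X]} {k r : ℕ} (hk : HasLength f k) (hr : HasLength f r) :
    k = r := by
  induction hn : f.natDegree using Nat.strong_induction_on generalizing f k r with
  | _ n ih =>
    have hf := hk.one_le_natDegree
    obtain hf1 | @⟨g, b, k, hg, hb⟩ := hk
    · generalize hF : f = F at hr
      obtain - | ⟨hg', hd⟩ := hr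
      · rfl
      · rw [hF, natDegree_comp] at hf1
        have := hd.1
        have := Nat.eq_one_of_mul_eq_one_left hf1
        omega
    generalize hF : g.comp b = F at hr
    obtain hF1 | @⟨g', d, r, hg', hd⟩ := hr
    · rw [← hF, natDegree_comp] at hF1
      have := hb.1
      have := Nat.eq_one_of_mul_eq_one_left hF1
      omega
    have hb2 := hb.1
    have hd2 := hd.1
    have hlt : g.natDegree < n := by
      have := hg.one_le_natDegree
      rw [← hn, natDegree_comp]
      nlinarith
    have hlt' : g'.natDegree < n := by
      have := hg'.one_le_natDegree
      rw [← hn, hF, natDegree_comp]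
      nlinarith
    obtain ⟨s, b', d', hs, hb', hd'⟩ := exists_common_right_factor hf rfl hF
    by_cases hs2 : 2 ≤ s.natDegree
    · obtain ⟨v, hv, -, hvb⟩ := exists_comp_eq_X (hb.natDegree_left hb' hs2)
      have hdb : d = (d'.comp v).comp b := by
        rw [hd', hb', Polynomial.comp_assoc, ← Polynomial.comp_assoc v, hvb, X_comp]
      have hg2 : g = g'.comp (d'.comp v) := by
        refine comp_right_cancel (b := b) (by omega) ?_
        rw [hF, Polynomial.comp_assoc, ← hdb]
      have hr := hg'.comp_linear (u := d'.comp v)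
        (by rw [natDegree_comp, hd.natDegree_left hd' hs2, hv])
      rw [ih _ hlt hg (hg2 ▸ hr) rfl]
    · have hs1 : b.natDegree.Coprime d.natDegree := by
        have := Nat.gcd_pos_of_pos_left d.natDegree (by omega : 0 < b.natDegree)
        rw [Nat.Coprime]
        omega
      obtain ⟨p, q, t, hpq, hdeg, ht⟩ := exists_common_left_multiple hf rfl hF
      rw [hs1.lcm_eq_mul] at hdeg
      have hp : p.natDegree = d.natDegree := by
        rw [natDegree_comp, mul_comm] at hdeg
        exact Nat.eq_of_mul_eq_mul_left (by omega) hdeg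
      have hq : q.natDegree = b.natDegree := by
        rw [hpq, natDegree_comp] at hdeg
        exact Nat.eq_of_mul_eq_mul_right (by omega) hdeg
      have hpi := hd.of_comp_eq_comp hpq (by omega) hs1 hp
      have hqi := hb.of_comp_eq_comp hpq.symm (by omega) hs1.symm hq
      have hgp : g = t.comp p :=
        comp_right_cancel (b := b) (by omega) (by rw [ht, Polynomial.comp_assoc])
      have hgq : g' = t.comp q :=
        comp_right_cancel (b := d) (by omega) (by rw [← hF, ht, hpq, Polynomial.comp_assoc])
      obtain ⟨j, hj⟩ := exists_hasLength (f := t) (by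
        have := hg.one_le_natDegree
        rw [hgp, natDegree_comp] at this
        exact Nat.pos_of_mul_pos_right this)
      rw [ih _ hlt hg (hgp ▸ hj.comp hpi) rfl, ih _ hlt' hg' (hgq ▸ hj.comp hqi) rfl]

theorem foldl_comp_eq (l : List ℂ[X]) (r : ℂ[X]) :
    l.foldl (fun q p => p.comp q) r = (l.foldl (fun q p => p.comp q) X).comp r := by
  induction l generalizing r with
  | nil => exact X_comp.symm
  | cons b l ih => rw [List.foldl_cons, List.foldl_cons, ih, comp_X, ih b, Polynomial.comp_assoc]

theorem hasLength_foldl {l : List ℂ[X]} (hl : ∀ p ∈ l, Indecomposable p) :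
    HasLength (l.foldl (fun q p => p.comp q) X) l.length := by
  induction l with
  | nil => exact .linear natDegree_X
  | cons b l ih =>
    rw [List.foldl_cons, comp_X, foldl_comp_eq]
    exact .comp (ih fun p hp => hl p (List.mem_cons_of_mem _ hp)) (hl b List.mem_cons_self)

/-- Any two decompositions of a polynomial of degree at least 2 into indecomposable
factors have the same length. -/
theorem decompositions_same_length (f : ℂ[X]) (hf : 2 ≤ f.natDegree)
    (l m : List ℂ[X]) (hl : IsDecomposition l f) (hm : IsDecomposition m f) :
    l.length = m.length := by
  have h1 := hasLength_foldl hl.2.1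
  have h2 := hasLength_foldl hm.2.1
  rw [hl.2.2] at h1
  rw [hm.2.2] at h2
  exact h1.unique h2
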